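/- arXiv:2605.09432 — 4 statements merged into one kernel-verified Lean document; each statement's English description precedes it below -/
import Mathlib

section
/- If the 3SAT instance φ is satisfiable, then the demand set E_φ of the reduction admits a 2-hop solution of length k = 12N² + 18NM + 27N + 39M. -/
/-- A demand `(i,j)` is served by schedule `L` along a path of length `ℓ ≥ 1`:
there are flights at increasing positions of `L` forming a path `i = w₀, w₁, …, w_ℓ = j`.
This is encoded by a node list `w` of length `ℓ + 1` whose list of consecutive pairs
is a sublist (ordered subsequence) of `L`. -/
def ServesPath {V : Type*} (L : List (V × V)) (i j : V) (ℓ : ℕ) : Prop :=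
  1 ≤ ℓ ∧ ∃ w : List V, w.length = ℓ + 1 ∧ w.head? = some i ∧ w.getLast? = some j ∧
    (w.zip w.tail).Sublist L

/-- `L` is a 2-hop solution for the demand set `E`: every demand is served
along a path of length at most 2. -/
def IsTwoHopSolution {V : Type*} (L : List (V × V)) (E : Set (V × V)) : Prop :=
  ∀ p ∈ E, ∃ ℓ ≤ 2, ServesPath L p.1 p.2 ℓ

/-- The nodes of the reduction from a 3SAT instance with `M` clauses over variables
`Fin N` (a literal is a pair `(j, s)` with `s : Bool`, `true` = positive):
a node for each clause, a node for each literal, a special star node, and, for every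
(potential) forced-edge index `e` and every `i : Fin (2N+4)`, three gadget nodes.
A forced-edge index is either `(i, j, s)` (the edge from clause `i` to literal `(j,s)`,
actual when `(j,s)` occurs in clause `i`) or `(j, s)` (the edge from literal `(j,s)`
to its negation). -/
inductive PNode (N M : ℕ) : Type where
  | clause : Fin M → PNode N M
  | lit : Fin N → Bool → PNode N M
  | star : PNode N M
  | gadget : (Fin M × Fin N × Bool) ⊕ (Fin N × Bool) → Fin (2 * N + 4) → Fin 3 → PNode N M
  deriving DecidableEq

/-- The forced-edge index `e` is an actual forced edge of the instance `φ`. -/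
def IsForced {N M : ℕ} (φ : Fin M → Finset (Fin N × Bool)) :
    (Fin M × Fin N × Bool) ⊕ (Fin N × Bool) → Prop
  | .inl (i, j, s) => (j, s) ∈ φ i
  | .inr _ => True

/-- Source node of a forced edge. -/
def fsrc {N M : ℕ} : (Fin M × Fin N × Bool) ⊕ (Fin N × Bool) → PNode N M
  | .inl (i, _, _) => .clause i
  | .inr (j, s) => .lit j s

/-- Destination node of a forced edge. -/
def fdst {N M : ℕ} : (Fin M × Fin N × Bool) ⊕ (Fin N × Bool) → PNode N M
  | .inl (_, j, s) => .lit j s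
  | .inr (j, s) => .lit j !s

/-- The demand set `E_φ` of the reduction: all forced edges; `(C_i, ★)` for every
clause; `(x_j, ★)` and `(x̄_j, ★)` for every variable; and, for every forced edge
`e = (a, b)` and every `i : Fin (2N+4)`, the six gadget demands
`(u^e_{i,1}, u^e_{i,2})`, `(u^e_{i,1}, u^e_{i,3})`, `(u^e_{i,2}, u^e_{i,3})`,
`(u^e_{i,2}, a)`, `(u^e_{i,3}, a)`, `(u^e_{i,3}, b)`. -/
def Ephi {N M : ℕ} (φ : Fin M → Finset (Fin N × Bool)) :
    Set (PNode N M × PNode N M) :=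
  {p | (∃ e, IsForced φ e ∧ p = (fsrc e, fdst e)) ∨
       (∃ i : Fin M, p = (.clause i, .star)) ∨
       (∃ (j : Fin N) (s : Bool), p = (.lit j s, .star)) ∨
       (∃ e, IsForced φ e ∧ ∃ i : Fin (2 * N + 4),
          p = (.gadget e i 0, .gadget e i 1) ∨
          p = (.gadget e i 0, .gadget e i 2) ∨
          p = (.gadget e i 1, .gadget e i 2) ∨
          p = (.gadget e i 1, fsrc e) ∨
          p = (.gadget e i 2, fsrc e) ∨
          p = (.gadget e i 2, fdst e))}

theorem ServesPath.of_sublist_one {V : Type*} {L : List (V × V)} {i j : V}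
    (h : [(i, j)].Sublist L) : ∃ ℓ ≤ 2, ServesPath L i j ℓ :=
  ⟨1, by norm_num, le_rfl, [i, j], rfl, rfl, rfl, h⟩

theorem ServesPath.of_sublist_two {V : Type*} {L : List (V × V)} {i k j : V}
    (h : [(i, k), (k, j)].Sublist L) : ∃ ℓ ≤ 2, ServesPath L i j ℓ :=
  ⟨2, le_rfl, by norm_num, [i, k, j], rfl, rfl, rfl, h⟩

theorem List.sublist_flatMap_of_mem {α β : Type*} {l : List α} {a : α} (h : a ∈ l)
    (f : α → List β) : (f a).Sublist (l.flatMap f) := by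
  rw [List.flatMap_def]
  exact List.sublist_flatten_of_mem (List.mem_map_of_mem h)

/-- The forced edges leaving clause nodes. -/
noncomputable def clauseEdges {N M : ℕ} (φ : Fin M → Finset (Fin N × Bool)) :
    List ((Fin M × Fin N × Bool) ⊕ (Fin N × Bool)) :=
  (List.finRange M).flatMap fun i => (φ i).toList.map fun l => .inl (i, l)

/-- The forced edges between opposite literals. -/
def literalEdges (N M : ℕ) : List ((Fin M × Fin N × Bool) ⊕ (Fin N × Bool)) :=
  (List.finRange N).flatMap fun j => [.inr (j, true), .inr (j, false)]

/-- The flights `u₁ → u₂ → u₃ → a` of the `i`-th gadget of the forced edge `e = (a, b)`. -/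
def gadgetFlights {N M : ℕ} (e : (Fin M × Fin N × Bool) ⊕ (Fin N × Bool))
    (i : Fin (2 * N + 4)) : List (PNode N M × PNode N M) :=
  [(.gadget e i 0, .gadget e i 1), (.gadget e i 1, .gadget e i 2), (.gadget e i 2, fsrc e)]

/-- The flights `f → t`, `t → ★`, `t → f`, where `t` and `f` are the true and the false literal
of the variable `j`. -/
def variableFlights {N : ℕ} (M : ℕ) (α : Fin N → Bool) (j : Fin N) :
    List (PNode N M × PNode N M) :=
  [(.lit j !α j, .lit j (α j)), (.lit j (α j), .star), (.lit j (α j), .lit j !α j)]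

/-- All gadget flights, in any order of the gadgets. -/
noncomputable def gadgetSchedule {N M : ℕ} (φ : Fin M → Finset (Fin N × Bool)) :
    List (PNode N M × PNode N M) :=
  (clauseEdges φ ++ literalEdges N M).flatMap fun e =>
    (List.finRange (2 * N + 4)).flatMap (gadgetFlights e)

/-- The flights along the forced edges, and one flight to `★` from every true literal. -/
noncomputable def coreSchedule {N M : ℕ} (φ : Fin M → Finset (Fin N × Bool)) (α : Fin N → Bool) :
    List (PNode N M × PNode N M) :=
  (clauseEdges φ).map (fun e => (fsrc e, fdst e)) ++
    (List.finRange N).flatMap (variableFlights M α)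

theorem inl_mem_clauseEdges {N M : ℕ} {φ : Fin M → Finset (Fin N × Bool)} {i : Fin M}
    {l : Fin N × Bool} (h : l ∈ φ i) : .inl (i, l) ∈ clauseEdges φ := by
  simp only [clauseEdges, List.mem_flatMap, List.mem_map, Finset.mem_toList]
  exact ⟨i, List.mem_finRange i, l, h, rfl⟩

theorem mem_edges_of_isForced {N M : ℕ} {φ : Fin M → Finset (Fin N × Bool)}
    {e : (Fin M × Fin N × Bool) ⊕ (Fin N × Bool)} (he : IsForced φ e) :
    e ∈ clauseEdges φ ++ literalEdges N M := by
  rcases e with ⟨i, j, s⟩ | ⟨j, s⟩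
  · exact List.mem_append_left _ (inl_mem_clauseEdges he)
  · refine List.mem_append_right _ ?_
    cases s <;> simp [literalEdges]

theorem gadgetFlights_sublist_gadgetSchedule {N M : ℕ} {φ : Fin M → Finset (Fin N × Bool)}
    {e : (Fin M × Fin N × Bool) ⊕ (Fin N × Bool)} (he : IsForced φ e) (i : Fin (2 * N + 4)) :
    (gadgetFlights e i).Sublist (gadgetSchedule φ) :=
  (List.sublist_flatMap_of_mem (List.mem_finRange i) _).trans
    (List.sublist_flatMap_of_mem (mem_edges_of_isForced he)
      fun e => (List.finRange (2 * N + 4)).flatMap (gadgetFlights e))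

theorem variableFlights_sublist {N : ℕ} (M : ℕ) (α : Fin N → Bool) (j : Fin N) :
    (variableFlights M α j).Sublist ((List.finRange N).flatMap (variableFlights M α)) :=
  List.sublist_flatMap_of_mem (List.mem_finRange j) _

theorem edge_mem_coreSchedule {N M : ℕ} {φ : Fin M → Finset (Fin N × Bool)} (α : Fin N → Bool)
    {e : (Fin M × Fin N × Bool) ⊕ (Fin N × Bool)} (he : IsForced φ e) :
    (fsrc e, fdst e) ∈ coreSchedule φ α := by
  rcases e with ⟨i, j, s⟩ | ⟨j, s⟩
  · exact List.mem_append_left _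
      (List.mem_map_of_mem (f := fun e => (fsrc e, fdst e)) (inl_mem_clauseEdges he))
  · refine List.mem_append_right _ ((variableFlights_sublist M α j).subset ?_)
    cases s <;> cases h : α j <;> simp [variableFlights, fsrc, fdst, h]

theorem length_clauseEdges {N M : ℕ} {φ : Fin M → Finset (Fin N × Bool)}
    (hφ : ∀ i, (φ i).card = 3) : (clauseEdges φ).length = M * 3 := by
  simp [clauseEdges, List.length_flatMap, hφ]

theorem length_literalEdges (N M : ℕ) : (literalEdges N M).length = N * 2 := by
  simp [literalEdges, List.length_flatMap]

theorem length_gadgetSchedule {N M : ℕ} {φ : Fin M → Finset (Fin N × Bool)}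
    (hφ : ∀ i, (φ i).card = 3) :
    (gadgetSchedule φ).length = (M * 3 + N * 2) * ((2 * N + 4) * 3) := by
  simp [gadgetSchedule, gadgetFlights, List.length_flatMap, length_clauseEdges hφ,
    length_literalEdges, add_mul]

theorem length_coreSchedule {N M : ℕ} {φ : Fin M → Finset (Fin N × Bool)}
    (hφ : ∀ i, (φ i).card = 3) (α : Fin N → Bool) :
    (coreSchedule φ α).length = M * 3 + N * 3 := by
  simp [coreSchedule, variableFlights, List.length_flatMap, length_clauseEdges hφ]

theorem isTwoHopSolution_schedule {N M : ℕ} {φ : Fin M → Finset (Fin N × Bool)}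
    {α : Fin N → Bool} (hα : ∀ i, ∃ l ∈ φ i, α l.1 = l.2) :
    IsTwoHopSolution (gadgetSchedule φ ++ coreSchedule φ α) (Ephi φ) := by
  have core {l} (h : List.Sublist l (coreSchedule φ α)) :
      l.Sublist (gadgetSchedule φ ++ coreSchedule φ α) :=
    h.trans (List.sublist_append_right _ _)
  have var (j) : (variableFlights M α j).Sublist (coreSchedule φ α) :=
    (variableFlights_sublist M α j).trans (List.sublist_append_right _ _)
  have gadget {e} (he : IsForced φ e) (i) :
      (gadgetFlights e i).Sublist (gadgetSchedule φ ++ coreSchedule φ α) :=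
    (gadgetFlights_sublist_gadgetSchedule he i).trans (List.sublist_append_left _ _)
  rintro p (⟨e, he, rfl⟩ | ⟨i, rfl⟩ | ⟨j, s, rfl⟩ | ⟨e, he, i, rfl | rfl | rfl | rfl | rfl | rfl⟩)
  · exact ServesPath.of_sublist_one (core (List.singleton_sublist.2 (edge_mem_coreSchedule α he)))
  · obtain ⟨⟨j, s⟩, hl, hs⟩ := hα i
    obtain rfl : α j = s := hs
    refine ServesPath.of_sublist_two (k := .lit j (α j)) (core ?_)
    refine List.Sublist.append (l₁ := [_]) (r₁ := [_]) (List.singleton_sublist.2 ?_)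
      (List.singleton_sublist.2 ((variableFlights_sublist M α j).subset ?_))
    · exact List.mem_map_of_mem (f := fun e => (fsrc e, fdst e)) (inl_mem_clauseEdges hl)
    · simp [variableFlights]
  · by_cases h : s = α j
    · subst h
      refine ServesPath.of_sublist_one (core (List.Sublist.trans ?_ (var j)))
      simp [variableFlights]
    · obtain rfl : s = !α j := Bool.eq_not.2 h
      refine ServesPath.of_sublist_two (k := .lit j (α j)) (core (List.Sublist.trans ?_ (var j)))
      simp [variableFlights]
  · refine ServesPath.of_sublist_one (List.Sublist.trans ?_ (gadget he i))
    simp [gadgetFlights]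
  · refine ServesPath.of_sublist_two (k := .gadget e i 1) (List.Sublist.trans ?_ (gadget he i))
    simp [gadgetFlights]
  · refine ServesPath.of_sublist_one (List.Sublist.trans ?_ (gadget he i))
    simp [gadgetFlights]
  · refine ServesPath.of_sublist_two (k := .gadget e i 2) (List.Sublist.trans ?_ (gadget he i))
    exact List.Sublist.cons _ (List.Sublist.refl _)
  · refine ServesPath.of_sublist_one (List.Sublist.trans ?_ (gadget he i))
    simp [gadgetFlights]
  · refine ServesPath.of_sublist_two (k := fsrc e) ?_
    refine List.Sublist.append (l₁ := [_]) (r₁ := [_]) (List.singleton_sublist.2 ?_)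
      (List.singleton_sublist.2 (edge_mem_coreSchedule α he))
    exact (gadgetFlights_sublist_gadgetSchedule he i).subset (by simp [gadgetFlights])

/-- If the 3SAT instance `φ` (with `M` clauses of exactly three distinct literals each,
over `N` variables) is satisfiable, then the demand set `E_φ` of the reduction admits a
2-hop solution of length `k = 12N² + 18NM + 27N + 39M`. -/
theorem sat_to_twohop (N M : ℕ) (φ : Fin M → Finset (Fin N × Bool))
    (hφ : ∀ i, (φ i).card = 3)
    (α : Fin N → Bool) (hα : ∀ i, ∃ l ∈ φ i, α l.1 = l.2) :
    ∃ L : List (PNode N M × PNode N M), IsTwoHopSolution L (Ephi φ) ∧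
      L.length = 12 * N ^ 2 + 18 * N * M + 27 * N + 39 * M := by
  refine ⟨gadgetSchedule φ ++ coreSchedule φ α, isTwoHopSolution_schedule hα, ?_⟩
  rw [List.length_append, length_gadgetSchedule hφ, length_coreSchedule hφ]
  ring
end

section
/- If the demand set E_φ of the reduction admits a 2-hop solution of length at most k = 12N² + 18NM + 27N + 39M, then the 3SAT instance φ is satisfiable. -/
/-- A demand served along a path of length at most two is either flown directly or through
one intermediate node. -/
lemma ServesPath.mem_or_exists_mem {V : Type*} {L : List (V × V)} {i j : V} {ℓ : ℕ}
    (hℓ : ℓ ≤ 2) (h : ServesPath L i j ℓ) :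
    (i, j) ∈ L ∨ ∃ w, (i, w) ∈ L ∧ (w, j) ∈ L := by
  obtain ⟨h1, w, hlen, hhead, hlast, hsub⟩ := h
  match w, hlen with
  | [], hlen => simp at hlen
  | [a], hlen => simp at hlen; omega
  | [a, b], _ =>
    simp only [List.head?_cons, Option.some.injEq, List.getLast?_cons_cons,
      List.getLast?_singleton] at hhead hlast
    subst hhead hlast
    exact Or.inl (hsub.subset (by simp))
  | [a, b, c], _ =>
    simp only [List.head?_cons, Option.some.injEq, List.getLast?_cons_cons,
      List.getLast?_singleton] at hhead hlast
    subst hhead hlast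
    exact Or.inr ⟨b, hsub.subset (by simp), hsub.subset (by simp)⟩
  | a :: b :: c :: d :: w, hlen => simp at hlen; omega

/-- A node is a gadget node. -/
def PNode.IsGadget {N M : ℕ} : PNode N M → Prop
  | .gadget _ _ _ => True
  | _ => False

section Reduction

variable {N M : ℕ}

lemma not_isGadget_fsrc (e : (Fin M × Fin N × Bool) ⊕ (Fin N × Bool)) :
    ¬ (fsrc e).IsGadget := by
  rcases e with ⟨i, j, s⟩ | ⟨j, s⟩ <;> simp [fsrc, PNode.IsGadget]

lemma not_isGadget_fdst (e : (Fin M × Fin N × Bool) ⊕ (Fin N × Bool)) :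
    ¬ (fdst e).IsGadget := by
  rcases e with ⟨i, j, s⟩ | ⟨j, s⟩ <;> simp [fdst, PNode.IsGadget]

lemma fsrc_ne_fdst (e : (Fin M × Fin N × Bool) ⊕ (Fin N × Bool)) : fsrc e ≠ fdst e := by
  rcases e with ⟨i, j, s⟩ | ⟨j, s⟩ <;> simp [fsrc, fdst]

lemma injective_fsrc_fdst :
    Function.Injective fun e : (Fin M × Fin N × Bool) ⊕ (Fin N × Bool) => (fsrc e, fdst e) := by
  rintro (⟨i, j, s⟩ | ⟨j, s⟩) (⟨i', j', s'⟩ | ⟨j', s'⟩) h <;> simp_all [fsrc, fdst]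

/-- The finite set of forced-edge indices. -/
def forcedEdges (φ : Fin M → Finset (Fin N × Bool)) :
    Finset ((Fin M × Fin N × Bool) ⊕ (Fin N × Bool)) :=
  (Finset.univ.filter fun p : Fin M × Fin N × Bool => p.2 ∈ φ p.1).disjSum Finset.univ

lemma mem_forcedEdges {φ : Fin M → Finset (Fin N × Bool)}
    {e : (Fin M × Fin N × Bool) ⊕ (Fin N × Bool)} : e ∈ forcedEdges φ ↔ IsForced φ e := by
  rcases e with ⟨i, j, s⟩ | ⟨j, s⟩ <;> simp [forcedEdges, IsForced]

lemma card_forcedEdges {φ : Fin M → Finset (Fin N × Bool)} (hφ : ∀ i, (φ i).card = 3) :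
    (forcedEdges φ).card = 3 * M + 2 * N := by
  have h : (Finset.univ.filter fun p : Fin M × Fin N × Bool => p.2 ∈ φ p.1).card = M * 3 := by
    rw [Finset.card_filter, Fintype.sum_prod_type]
    simp [hφ]
  simp [forcedEdges, Finset.card_disjSum, h]
  ring

/-- The set-level consequence of being a 2-hop solution: each demand is a flight or a
concatenation of two flights. -/
def TwoHopCovers {V : Type*} (S : Finset (V × V)) (E : Set (V × V)) : Prop :=
  ∀ a b, (a, b) ∈ E → (a, b) ∈ S ∨ ∃ w, (a, w) ∈ S ∧ (w, b) ∈ S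

variable {φ : Fin M → Finset (Fin N × Bool)} {S : Finset (PNode N M × PNode N M)}

lemma TwoHopCovers.exists_gadget_out (hS : TwoHopCovers S (Ephi φ))
    {e : (Fin M × Fin N × Bool) ⊕ (Fin N × Bool)} (he : IsForced φ e)
    (i : Fin (2 * N + 4)) (t : Fin 3) : ∃ d, (PNode.gadget e i t, d) ∈ S := by
  have key : ∀ b, (PNode.gadget e i t, b) ∈ Ephi φ → ∃ d, (PNode.gadget e i t, d) ∈ S := by
    intro b hb
    rcases hS _ _ hb with h | ⟨w, h, -⟩
    exacts [⟨_, h⟩, ⟨_, h⟩]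
  fin_cases t
  · exact key (.gadget e i 1) (Or.inr (Or.inr (Or.inr ⟨e, he, i, by simp⟩)))
  · exact key (.gadget e i 2) (Or.inr (Or.inr (Or.inr ⟨e, he, i, by simp⟩)))
  · exact key (fsrc e) (Or.inr (Or.inr (Or.inr ⟨e, he, i, by simp⟩)))

/-- One flight can be chosen out of every gadget node, leading to a node outside all gadgets
whenever some flight does. -/
lemma TwoHopCovers.exists_base (hS : TwoHopCovers S (Ephi φ)) :
    ∃ β : PNode N M → PNode N M, ∀ e, IsForced φ e → ∀ i t,
      (PNode.gadget e i t, β (.gadget e i t)) ∈ S ∧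
      ∀ d, (PNode.gadget e i t, d) ∈ S → ¬ d.IsGadget → ¬ (β (.gadget e i t)).IsGadget := by
  have h : ∀ v : PNode N M, ∃ b, ∀ e, IsForced φ e → ∀ i t, v = .gadget e i t →
      (v, b) ∈ S ∧ ∀ d, (v, d) ∈ S → ¬ d.IsGadget → ¬ b.IsGadget := by
    intro v
    by_cases hd : ∃ d, (v, d) ∈ S ∧ ¬ d.IsGadget
    · obtain ⟨d, hd, hg⟩ := hd
      exact ⟨d, fun _ _ _ _ _ => ⟨hd, fun _ _ _ => hg⟩⟩
    · by_cases hv : ∃ b, (v, b) ∈ S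
      · obtain ⟨b, hb⟩ := hv
        exact ⟨b, fun _ _ _ _ _ => ⟨hb, fun d h1 h2 => (hd ⟨d, h1, h2⟩).elim⟩⟩
      · refine ⟨v, fun e he i t hv' => (hv ?_).elim⟩
        rw [hv']
        exact hS.exists_gadget_out he i t
  choose β hβ using h
  exact ⟨β, fun e he i t => hβ _ e he i t rfl⟩

/-- If a forced edge is not flown directly, each of its gadgets is left by a flight different
from the chosen ones, or its third node is entered by such a flight. -/
lemma TwoHopCovers.exists_excess (hS : TwoHopCovers S (Ephi φ)) {β : PNode N M → PNode N M}
    (hβ : ∀ e, IsForced φ e → ∀ i t,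
      (PNode.gadget e i t, β (.gadget e i t)) ∈ S ∧
      ∀ d, (PNode.gadget e i t, d) ∈ S → ¬ d.IsGadget → ¬ (β (.gadget e i t)).IsGadget)
    {e : (Fin M × Fin N × Bool) ⊕ (Fin N × Bool)} (he : IsForced φ e)
    (hdir : (fsrc e, fdst e) ∉ S) (i : Fin (2 * N + 4)) :
    ∃ f ∈ S, (∀ e', IsForced φ e' → ∀ i' t,
        f ≠ (PNode.gadget e' i' t, β (.gadget e' i' t))) ∧
      ((∃ t, f.1 = .gadget e i t) ∨ f.2 = .gadget e i 2) := by
  by_contra! hcon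
  have hout : ∀ t d, (PNode.gadget e i t, d) ∈ S → d = β (.gadget e i t) := by
    intro t d hd
    by_contra hne
    refine (hcon _ hd ?_).1 t rfl
    rintro e' - i' t' heq
    simp only [Prod.mk.injEq] at heq
    exact hne (heq.2.trans (by rw [heq.1]))
  have huniq : ∀ t d d', (PNode.gadget e i t, d) ∈ S → (PNode.gadget e i t, d') ∈ S → d = d' :=
    fun t d d' h h' => (hout t d h).trans (hout t d' h').symm
  have hga : ∀ t, PNode.gadget e i t ≠ fsrc e := fun t h =>
    not_isGadget_fsrc e (h ▸ trivial)
  have hdem : ∀ p : PNode N M × PNode N M, (p = (.gadget e i 0, .gadget e i 1) ∨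
      p = (.gadget e i 0, .gadget e i 2) ∨ p = (.gadget e i 1, .gadget e i 2) ∨
      p = (.gadget e i 1, fsrc e) ∨ p = (.gadget e i 2, fsrc e) ∨
      p = (.gadget e i 2, fdst e)) → p ∈ Ephi φ :=
    fun p hp => Or.inr (Or.inr (Or.inr ⟨e, he, i, hp⟩))
  have h23 := hS (.gadget e i 1) (.gadget e i 2) (hdem _ (by simp))
  have h2a := hS (.gadget e i 1) (fsrc e) (hdem _ (by simp))
  have h3b := hS (.gadget e i 2) (fdst e) (hdem _ (by simp))
  -- The third node cannot be reached directly from the second one.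
  have hndir : (PNode.gadget e i 1, PNode.gadget e i 2) ∉ S := by
    intro h
    have h3a : (PNode.gadget e i 2, fsrc e) ∈ S := by
      rcases h2a with h' | ⟨w, h', hw⟩
      · exact (hga 2 (huniq 1 _ _ h h')).elim
      · rwa [huniq 1 _ _ h h']
    rcases h3b with h' | ⟨w, h', hw⟩
    · exact fsrc_ne_fdst e (huniq 2 _ _ h3a h')
    · rw [← huniq 2 _ _ h3a h'] at hw
      exact hdir hw
  obtain ⟨w, h2w, hw3⟩ := h23.resolve_left hndir
  have hwa : w = fsrc e ∨ (w, fsrc e) ∈ S := by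
    rcases h2a with h' | ⟨w', h', hw⟩
    · exact Or.inl (huniq 1 _ _ h2w h')
    · exact Or.inr (huniq 1 _ _ h2w h' ▸ hw)
  refine (hcon _ hw3 ?_).2 rfl
  rintro e' he' i' t heq
  simp only [Prod.mk.injEq] at heq
  obtain ⟨rfl, hb⟩ := heq
  rcases hwa with h | h
  · exact not_isGadget_fsrc e (h ▸ trivial)
  · exact (hβ e' he' i' t).2 _ h (not_isGadget_fsrc e) (hb ▸ trivial)

/-- Every variable has a flight out of one of its literal nodes that is not a forced edge. -/
lemma TwoHopCovers.exists_lit_out (hS : TwoHopCovers S (Ephi φ)) (j : Fin N) :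
    ∃ f ∈ S, (∃ s, f.1 = .lit j s) ∧ ∀ e, f ≠ (fsrc e, fdst e) := by
  by_contra! hcon
  have hnot : ∀ s d, (PNode.lit j s, d) ∈ S → d = .lit j !s := by
    intro s d hd
    obtain ⟨e, he⟩ := hcon _ hd ⟨s, rfl⟩
    rcases e with ⟨i', j', s'⟩ | ⟨j', s'⟩
    · simp [fsrc] at he
    · simp only [fsrc, fdst, Prod.mk.injEq, PNode.lit.injEq] at he
      obtain ⟨⟨rfl, rfl⟩, rfl⟩ := he
      rfl
  rcases hS (.lit j true) .star (Or.inr (Or.inr (Or.inl ⟨j, true, rfl⟩))) with h | ⟨w, h, hw⟩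
  · simpa using hnot _ _ h
  · rw [hnot _ _ h] at hw
    simpa using hnot _ _ hw

/-- In a family of pairs whose excess flights leave the gadget or enter its third node, every
flight is used at most twice. -/
lemma card_mul_le_two_mul_card {D : Finset ((Fin M × Fin N × Bool) ⊕ (Fin N × Bool))}
    {R : Finset (PNode N M × PNode N M)}
    (h : ∀ e ∈ D, ∀ i : Fin (2 * N + 4), ∃ f ∈ R,
      (∃ t, f.1 = .gadget e i t) ∨ f.2 = .gadget e i 2) :
    D.card * (2 * N + 4) ≤ 2 * R.card := by
  classical
  set P := D ×ˢ (Finset.univ : Finset (Fin (2 * N + 4))) with hP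
  have h' : ∀ p : P, ∃ f ∈ R,
      (∃ t, f.1 = .gadget p.1.1 p.1.2 t) ∨ f.2 = .gadget p.1.1 p.1.2 2 :=
    fun p => h _ (Finset.mem_product.1 p.2).1 _
  choose f hfR hf using h'
  let Q : P → Prop := fun p => ∃ t, (f p).1 = .gadget p.1.1 p.1.2 t
  have h1 : (Finset.univ.filter Q).card ≤ R.card := by
    refine Finset.card_le_card_of_injOn f (fun p _ => hfR p) ?_
    intro p hp q hq hpq
    obtain ⟨t, ht⟩ := (Finset.mem_filter.1 hp).2
    obtain ⟨t', ht'⟩ := (Finset.mem_filter.1 hq).2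
    rw [hpq, ht'] at ht
    simp only [PNode.gadget.injEq] at ht
    exact Subtype.ext (Prod.ext ht.1.symm ht.2.1.symm)
  have h2 : (Finset.univ.filter fun p => ¬ Q p).card ≤ R.card := by
    refine Finset.card_le_card_of_injOn f (fun p _ => hfR p) ?_
    intro p hp q hq hpq
    have ht := (hf p).resolve_left (Finset.mem_filter.1 hp).2
    have ht' := (hf q).resolve_left (Finset.mem_filter.1 hq).2
    rw [hpq, ht'] at ht
    simp only [PNode.gadget.injEq, and_true] at ht
    exact Subtype.ext (Prod.ext ht.1.symm ht.2.symm)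
  have hc : P.card = D.card * (2 * N + 4) := by simp [hP]
  have hs := Finset.card_filter_add_card_filter_not (s := (Finset.univ : Finset P)) Q
  rw [Finset.card_univ, Fintype.card_coe, hc] at hs
  omega

/-- A small set of flights covering `E_φ` contains all forced edges, and all but `N` of its
flights start in a gadget or are forced edges. -/
lemma TwoHopCovers.exists_residual (hS : TwoHopCovers S (Ephi φ))
    (hφ : ∀ i, (φ i).card = 3)
    (hcard : S.card ≤ 12 * N ^ 2 + 18 * N * M + 27 * N + 39 * M) :
    ∃ R ⊆ S, R.card ≤ N ∧ ∀ f ∈ S, ¬ f.1.IsGadget →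
      f ∈ R ∨ ∃ e, IsForced φ e ∧ f = (fsrc e, fdst e) := by
  classical
  obtain ⟨β, hβ⟩ := hS.exists_base
  set F := forcedEdges φ with hF
  have hFc : F.card = 3 * M + 2 * N := card_forcedEdges hφ
  set B : Finset (PNode N M × PNode N M) :=
    (F ×ˢ (Finset.univ : Finset (Fin (2 * N + 4) × Fin 3))).image
      fun p => (.gadget p.1 p.2.1 p.2.2, β (.gadget p.1 p.2.1 p.2.2)) with hB
  have hBmem : ∀ f ∈ B, ∃ e, IsForced φ e ∧ ∃ i t, f = (.gadget e i t, β (.gadget e i t)) := by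
    intro f hf
    obtain ⟨⟨e, i, t⟩, hp, rfl⟩ := Finset.mem_image.1 hf
    exact ⟨e, mem_forcedEdges.1 (Finset.mem_product.1 hp).1, i, t, rfl⟩
  have hBS : B ⊆ S := by
    intro f hf
    obtain ⟨e, he, i, t, rfl⟩ := hBmem f hf
    exact (hβ e he i t).1
  have hBc : B.card = (3 * M + 2 * N) * ((2 * N + 4) * 3) := by
    rw [hB, Finset.card_image_of_injective, Finset.card_product, hFc]
    · simp
    · rintro ⟨e, i, t⟩ ⟨e', i', t'⟩ h
      simp only [Prod.mk.injEq, PNode.gadget.injEq] at h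
      simpa using h.1
  set A : Finset (PNode N M × PNode N M) :=
    (F.filter fun e => (fsrc e, fdst e) ∈ S).image fun e => (fsrc e, fdst e) with hA
  set D := F.filter fun e => (fsrc e, fdst e) ∉ S with hD
  have hAmem : ∀ f ∈ A, ∃ e, IsForced φ e ∧ f = (fsrc e, fdst e) := by
    intro f hf
    obtain ⟨e, he, rfl⟩ := Finset.mem_image.1 hf
    exact ⟨e, mem_forcedEdges.1 (Finset.mem_filter.1 he).1, rfl⟩
  have hAS : A ⊆ S := by
    intro f hf
    obtain ⟨e, he, rfl⟩ := Finset.mem_image.1 hf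
    exact (Finset.mem_filter.1 he).2
  have hAc : A.card + D.card = 3 * M + 2 * N := by
    rw [hA, Finset.card_image_of_injective _ injective_fsrc_fdst, ← hFc]
    exact Finset.card_filter_add_card_filter_not _
  have hdisj : Disjoint B A := by
    rw [Finset.disjoint_left]
    intro f hfB hfA
    obtain ⟨e, -, i, t, rfl⟩ := hBmem f hfB
    obtain ⟨e', -, h⟩ := hAmem _ hfA
    simp only [Prod.mk.injEq] at h
    exact not_isGadget_fsrc e' (h.1 ▸ trivial)
  have hRc : (S \ (B ∪ A)).card + (B.card + A.card) = S.card := by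
    rw [← Finset.card_union_of_disjoint hdisj]
    exact Finset.card_sdiff_add_card_eq_card (Finset.union_subset hBS hAS)
  have hRD : (S \ (B ∪ A)).card ≤ N + D.card := by
    rw [hBc] at hRc
    nlinarith
  have hDR : D.card * (2 * N + 4) ≤ 2 * (S \ (B ∪ A)).card := by
    refine card_mul_le_two_mul_card fun e he i => ?_
    obtain ⟨heF, hed⟩ := Finset.mem_filter.1 he
    obtain ⟨f, hfS, hfB, hf⟩ := hS.exists_excess hβ (mem_forcedEdges.1 heF) hed i
    refine ⟨f, Finset.mem_sdiff.2 ⟨hfS, fun hmem => ?_⟩, hf⟩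
    rcases Finset.mem_union.1 hmem with h | h
    · obtain ⟨e', he', i', t', rfl⟩ := hBmem f h
      exact hfB e' he' i' t' rfl
    · obtain ⟨e', -, rfl⟩ := hAmem f h
      rcases hf with ⟨t, ht⟩ | ht
      · exact not_isGadget_fsrc e' ((show fsrc e' = _ from ht) ▸ trivial)
      · exact not_isGadget_fdst e' ((show fdst e' = _ from ht) ▸ trivial)
  have hD0 : D.card = 0 := by
    by_contra hne
    have : 1 ≤ D.card := Nat.one_le_iff_ne_zero.2 hne
    nlinarith
  refine ⟨S \ (B ∪ A), Finset.sdiff_subset, by omega, fun f hf hg => ?_⟩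
  by_cases hfA : f ∈ A
  · exact Or.inr (hAmem f hfA)
  · refine Or.inl (Finset.mem_sdiff.2 ⟨hf, fun hmem => ?_⟩)
    obtain ⟨e, -, i, t, rfl⟩ := hBmem f ((Finset.mem_union.1 hmem).resolve_right hfA)
    exact hg trivial

/-- A small set of flights covering `E_φ` yields a satisfying assignment. -/
lemma TwoHopCovers.satisfiable (hS : TwoHopCovers S (Ephi φ)) (hφ : ∀ i, (φ i).card = 3)
    (hcard : S.card ≤ 12 * N ^ 2 + 18 * N * M + 27 * N + 39 * M) :
    ∃ α : Fin N → Bool, ∀ i, ∃ l ∈ φ i, α l.1 = l.2 := by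
  classical
  obtain ⟨R, -, hRN, hR⟩ := hS.exists_residual hφ hcard
  choose h hhS hhlit hhe using hS.exists_lit_out
  have hhR : ∀ j, h j ∈ R := by
    intro j
    obtain ⟨s, hs⟩ := hhlit j
    refine (hR _ (hhS j) (by simp [hs, PNode.IsGadget])).resolve_right ?_
    rintro ⟨e, -, he⟩
    exact hhe j e he
  have hinj : Function.Injective h := by
    intro j j' hjj
    obtain ⟨s, hs⟩ := hhlit j
    obtain ⟨s', hs'⟩ := hhlit j'
    rw [hjj, hs'] at hs
    simp only [PNode.lit.injEq] at hs
    exact hs.1.symm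
  have himg : Finset.univ.image h = R := by
    refine Finset.eq_of_subset_of_card_le (by simpa [Finset.subset_iff] using hhR) ?_
    rw [Finset.card_image_of_injective _ hinj]
    simpa using hRN
  have hRlit : ∀ f ∈ R, ∃ j, h j = f := fun f hf => by simpa [← himg] using hf
  have hstar : ∀ v : PNode N M, ¬ v.IsGadget → (v, PNode.star) ∈ S → (v, PNode.star) ∈ R := by
    intro v hv hvS
    refine (hR _ hvS hv).resolve_right ?_
    rintro ⟨e, -, he⟩
    rcases e with ⟨i, j, s⟩ | ⟨j, s⟩ <;> simp [fdst] at he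
  have hclause : ∀ i d, (PNode.clause i, d) ∉ R := by
    intro i d hd
    obtain ⟨j, hj⟩ := hRlit _ hd
    obtain ⟨s, hs⟩ := hhlit j
    simp [hj] at hs
  have hlit : ∀ j s, (PNode.lit j s, PNode.star) ∈ S → h j = (.lit j s, .star) := by
    intro j s hjs
    obtain ⟨j', hj'⟩ := hRlit _ (hstar _ (by simp [PNode.IsGadget]) hjs)
    obtain ⟨s', hs'⟩ := hhlit j'
    simp only [hj', PNode.lit.injEq] at hs'
    rw [hs'.1, hj', hs'.1]
  refine ⟨fun j => decide ((PNode.lit j true, PNode.star) ∈ S), fun i => ?_⟩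
  rcases hS (.clause i) .star (Or.inr (Or.inl ⟨i, rfl⟩)) with hi | ⟨w, hi, hw⟩
  · exact (hclause i _ (hstar _ (by simp [PNode.IsGadget]) hi)).elim
  · obtain ⟨e, he, hie⟩ := (hR _ hi (by simp [PNode.IsGadget])).resolve_left (hclause i w)
    rcases e with ⟨i', j, s⟩ | ⟨j, s⟩
    · simp only [fsrc, fdst, Prod.mk.injEq, PNode.clause.injEq] at hie
      obtain ⟨rfl, rfl⟩ := hie
      refine ⟨(j, s), he, ?_⟩
      cases s with
      | true => simpa using hw
      | false =>
        simp only [decide_eq_false_iff_not]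
        intro ht
        have := (hlit j true ht).symm.trans (hlit j false hw)
        simp at this
    · simp [fsrc] at hie

end Reduction

/-- If the demand set `E_φ` of the reduction admits a 2-hop solution of length at most
`k = 12N² + 18NM + 27N + 39M`, then the 3SAT instance `φ` (with `M` clauses of exactly
three distinct literals each, over `N` variables) is satisfiable. -/
theorem twohop_to_sat (N M : ℕ) (φ : Fin M → Finset (Fin N × Bool))
    (hφ : ∀ i, (φ i).card = 3)
    (L : List (PNode N M × PNode N M)) (hL : IsTwoHopSolution L (Ephi φ))
    (hlen : L.length ≤ 12 * N ^ 2 + 18 * N * M + 27 * N + 39 * M) :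
    ∃ α : Fin N → Bool, ∀ i, ∃ l ∈ φ i, α l.1 = l.2 := by
  have hS : TwoHopCovers L.toFinset (Ephi φ) := by
    intro a b hab
    obtain ⟨ℓ, hℓ, h⟩ := hL _ hab
    simpa using h.mem_or_exists_mem hℓ
  exact hS.satisfiable hφ (L.toFinset_card_le.trans hlen)
end

section
/- Let G = (V, E_G) be a connected undirected graph with |V| = n ≥ 2, and let E = {(u,v) : {u,v} ∈ E_G} ∪ {(v,u) : {u,v} ∈ E_G} be the associated symmetric demand set. If G has a vertex cover of size k, then there exists a multihop solution for E of length at most n + k − 1. -/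
/-- `L` is a multihop solution for the demand set `E`: every demand is served
along a path of some length `ℓ ≥ 1`. -/
def IsMultihopSolution {V : Type*} (L : List (V × V)) (E : Set (V × V)) : Prop :=
  ∀ p ∈ E, ∃ ℓ, ServesPath L p.1 p.2 ℓ

theorem List.zip_tail_sublist_append_left {α : Type*} (a s : List α) :
    (s.zip s.tail).Sublist ((a ++ s).zip (a ++ s).tail) := by
  induction a with
  | nil => simp
  | cons x a ih =>
    refine ih.trans ?_
    cases h : a ++ s <;> simp [h]

theorem List.zip_tail_sublist_append_right {α : Type*} (s c : List α) :
    (s.zip s.tail).Sublist ((s ++ c).zip (s ++ c).tail) := by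
  induction s with
  | nil => simp
  | cons x s ih =>
    cases s with
    | nil => simp
    | cons y s => simpa using ih

/-- The consecutive flights along a walk serve every node of an initial part to every node
of the remaining part. -/
theorem exists_servesPath_zip_tail_append {V : Type*} {p q : List V} {u v : V}
    (hu : u ∈ p) (hv : v ∈ q) :
    ∃ ℓ, ServesPath ((p ++ q).zip (p ++ q).tail) u v ℓ := by
  obtain ⟨a, b, rfl⟩ := List.append_of_mem hu
  obtain ⟨c, d, rfl⟩ := List.append_of_mem hv
  refine ⟨(b ++ c).length + 1, by omega, u :: (b ++ c) ++ [v], by simp [Nat.add_assoc], by simp,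
    List.getLast?_concat, ?_⟩
  have h := (List.zip_tail_sublist_append_right (u :: (b ++ c) ++ [v]) d).trans
    (List.zip_tail_sublist_append_left a _)
  simpa using h

/-- If a connected graph `G` on `n ≥ 2` nodes has a vertex cover of size `k`, then the
symmetric demand set `{(u,v) : G.Adj u v}` has a multihop solution of length at most
`n + k − 1`. -/
theorem vertexCover_to_multihop {V : Type*} [Fintype V] [DecidableEq V]
    (n : ℕ) (hn : 2 ≤ n) (hcard : Fintype.card V = n)
    (G : SimpleGraph V) (hconn : G.Connected)
    (K : Finset V) (hK : ∀ u v : V, G.Adj u v → u ∈ K ∨ v ∈ K)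
    (k : ℕ) (hk : K.card = k) :
    ∃ L : List (V × V),
      IsMultihopSolution L {p : V × V | G.Adj p.1 p.2} ∧ L.length ≤ n + k - 1 := by
  let w := K.toList ++ (Kᶜ.toList ++ K.toList)
  refine ⟨w.zip w.tail, ?_, ?_⟩
  · rintro ⟨u, v⟩ huv
    by_cases hu : u ∈ K
    · refine exists_servesPath_zip_tail_append (by simpa using hu) ?_
      by_cases hv : v ∈ K <;> simp [hv]
    · have hv : v ∈ K := (hK u v huv).resolve_left hu
      have h := exists_servesPath_zip_tail_append (p := K.toList ++ Kᶜ.toList)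
        (q := K.toList) (u := u) (v := v) (by simp [hu]) (by simpa using hv)
      simpa only [w, List.append_assoc] using h
  · have h := K.card_add_card_compl
    simp only [w, List.length_zip, List.length_tail, List.length_append, Finset.length_toList]
    omega
end

section
/- Let G = (V, E_G) be a connected undirected graph with |V| = n ≥ 2, and let E = {(u,v) : {u,v} ∈ E_G} ∪ {(v,u) : {u,v} ∈ E_G} be the associated symmetric demand set. If for some k ≥ 1 there exists a multihop solution for E of length at most n + k − 1, then G has a vertex cover of size at most k. -/
theorem not_servesPath_nil {V : Type*} (i j : V) (ℓ : ℕ) :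
    ¬ ServesPath ([] : List (V × V)) i j ℓ := by
  rintro ⟨hℓ, w, hw, -, -, hsub⟩
  have h := congrArg List.length (List.sublist_nil.mp hsub)
  simp only [List.length_zip, List.length_tail, List.length_nil] at h
  omega

/-- A path served by a schedule with first flight `(a, b)` either avoids that flight or
starts with it. -/
theorem ServesPath.of_cons {V : Type*} {L : List (V × V)} {a b i j : V} {ℓ : ℕ}
    (h : ServesPath ((a, b) :: L) i j ℓ) :
    (∃ ℓ', ServesPath L i j ℓ') ∨ i = a ∧ (j = b ∨ ∃ ℓ', ServesPath L b j ℓ') := by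
  obtain ⟨hℓ, w, hw, hhead, hlast, hsub⟩ := h
  rcases List.sublist_cons_iff.mp hsub with hsub' | ⟨r, hr, hsub'⟩
  · exact Or.inl ⟨ℓ, hℓ, w, hw, hhead, hlast, hsub'⟩
  · right
    match w, hw, hhead, hlast, hr with
    | [x, y], _, hhead, hlast, hr =>
      simp_all
    | x :: y :: z :: t, hw, hhead, hlast, hr =>
      simp only [List.tail_cons, List.zip_cons_cons, List.cons.injEq, Prod.mk.injEq] at hr
      obtain ⟨⟨rfl, rfl⟩, rfl⟩ := hr
      refine ⟨by simpa using hhead.symm, Or.inr ⟨t.length + 1, by omega, y :: z :: t, by simp,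
        rfl, by simpa using hlast, by simpa using hsub'⟩⟩

/-- The pairs of nodes that can reach each other in a schedule have a vertex cover whose size
is at most the cyclomatic number of the multigraph of flights. The labelling `c` is constant
on the connected components of that multigraph. -/
theorem exists_labelling_and_cover {V : Type*} [Fintype V] [DecidableEq V]
    (L : List (V × V)) :
    ∃ (c : V → V) (K : Finset V),
      (∀ u v ℓ, ServesPath L u v ℓ → c u = c v) ∧
      (∀ u v ℓ ℓ', ServesPath L u v ℓ → ServesPath L v u ℓ' → u ∈ K ∨ v ∈ K) ∧
      K.card + Fintype.card V ≤ L.length + (Finset.univ.image c).card := by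
  induction L with
  | nil =>
    exact ⟨id, ∅, fun u v ℓ h => (not_servesPath_nil u v ℓ h).elim,
      fun u v ℓ _ h => (not_servesPath_nil u v ℓ h).elim, by simp⟩
  | cons f L ih =>
    obtain ⟨a, b⟩ := f
    obtain ⟨c, K, hc, hK, hcard⟩ := ih
    by_cases hab : c a = c b
    · refine ⟨c, insert a K, fun u v ℓ h => ?_, fun u v ℓ ℓ' h h' => ?_, ?_⟩
      · rcases h.of_cons with ⟨_, h⟩ | ⟨rfl, rfl | ⟨_, h⟩⟩
        · exact hc _ _ _ h
        · exact hab
        · exact hab.trans (hc _ _ _ h)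
      · rcases h.of_cons with ⟨_, h⟩ | ⟨rfl, -⟩
        · rcases h'.of_cons with ⟨_, h'⟩ | ⟨rfl, -⟩
          · exact (hK _ _ _ _ h h').imp (Finset.mem_insert_of_mem) (Finset.mem_insert_of_mem)
          · exact Or.inr (Finset.mem_insert_self _ _)
        · exact Or.inl (Finset.mem_insert_self _ _)
      · have := Finset.card_insert_le a K
        simp only [List.length_cons]
        omega
    · have no_return : ∀ v ℓ, (v = b ∨ ∃ ℓ', ServesPath L b v ℓ') →
          ¬ ServesPath ((a, b) :: L) v a ℓ := by
        intro v ℓ hv h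
        have hbv : c b = c v := by
          rcases hv with rfl | ⟨_, hv⟩
          · rfl
          · exact hc _ _ _ hv
        rcases h.of_cons with ⟨_, h⟩ | ⟨rfl, -⟩
        · exact hab ((hbv.trans (hc _ _ _ h)).symm)
        · exact hab hbv.symm
      refine ⟨fun x => if c x = c b then c a else c x, K, fun u v ℓ h => ?_,
        fun u v ℓ ℓ' h h' => ?_, ?_⟩
      · rcases h.of_cons with ⟨_, h⟩ | ⟨rfl, rfl | ⟨_, h⟩⟩
        · simp only [hc _ _ _ h]
        · simp
        · simp [← hc _ _ _ h]
      · rcases h.of_cons with ⟨_, h₁⟩ | ⟨rfl, hv⟩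
        · rcases h'.of_cons with ⟨_, h₂⟩ | ⟨rfl, hu⟩
          · exact hK _ _ _ _ h₁ h₂
          · exact (no_return _ _ hu h).elim
        · exact (no_return _ _ hv h').elim
      · have hsub : (Finset.univ.image c).erase (c b) ⊆
            Finset.univ.image (fun x => if c x = c b then c a else c x) := by
          intro y hy
          obtain ⟨hne, hy⟩ := Finset.mem_erase.mp hy
          obtain ⟨x, -, rfl⟩ := Finset.mem_image.mp hy
          exact Finset.mem_image.mpr ⟨x, Finset.mem_univ x, if_neg hne⟩
        have h₁ := Finset.card_le_card hsub
        have h₂ := Finset.pred_card_le_card_erase (s := Finset.univ.image c) (a := c b)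
        simp only [List.length_cons]
        omega

/-- If, for some `k ≥ 1`, the symmetric demand set `{(u,v) : G.Adj u v}` of a connected
graph `G` on `n ≥ 2` nodes has a multihop solution of length at most `n + k − 1`, then
`G` has a vertex cover of size at most `k`. -/
theorem multihop_to_vertexCover {V : Type*} [Fintype V] [DecidableEq V]
    (n : ℕ) (hn : 2 ≤ n) (hcard : Fintype.card V = n)
    (G : SimpleGraph V) (hconn : G.Connected)
    (k : ℕ) (hk : 1 ≤ k)
    (L : List (V × V)) (hL : IsMultihopSolution L {p : V × V | G.Adj p.1 p.2})
    (hlen : L.length ≤ n + k - 1) :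
    ∃ K : Finset V, (∀ u v : V, G.Adj u v → u ∈ K ∨ v ∈ K) ∧ K.card ≤ k := by
  obtain ⟨c, K, hc, hK, hcard'⟩ := exists_labelling_and_cover L
  refine ⟨K, fun u v huv => ?_, ?_⟩
  · obtain ⟨ℓ, h⟩ := hL (u, v) huv
    obtain ⟨ℓ', h'⟩ := hL (v, u) huv.symm
    exact hK u v ℓ ℓ' h h'
  · have hconst : ∀ u v, c u = c v := by
      intro u v
      obtain ⟨p⟩ := hconn.preconnected u v
      induction p with
      | nil => rfl
      | cons huv _ ih =>
        obtain ⟨ℓ, h⟩ := hL (_, _) huv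
        exact (hc _ _ _ h).trans ih
    have hone : (Finset.univ.image c).card ≤ 1 := by
      refine Finset.card_le_one.mpr fun x hx y hy => ?_
      obtain ⟨u, -, rfl⟩ := Finset.mem_image.mp hx
      obtain ⟨v, -, rfl⟩ := Finset.mem_image.mp hy
      exact hconst u v
    omega
end
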